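/- Let 0 < p < 1, let 0 = x_0 < x_1 < ⋯ < x_N = 1 be a partition of [0,1], let X_1,…,X_N be half-open subintervals of [0,1], and let u_i : X_i → [x_{i-1}, x_i) be affine bijections (for i = N, u_N extended so as to map onto [x_{N-1}, x_N]), with |u_i'| = a_i. Let λ_i be measurable on X_i with ∫_{X_i} |λ_i|^p < ∞, let S_i ∈ L^∞(X_i), and define Φ by Φg := Σ_{i=1}^N (λ_i ∘ u_i^{-1})·χ_{u_i(X_i)} + Σ_{i=1}^N (S_i ∘ u_i^{-1})·(g|_{X_i} ∘ u_i^{-1})·χ_{u_i(X_i)}. Then Φ maps the space L^p[0,1] := {g measurable : ∫_0^1 |g|^p dx < ∞} into itself and satisfies d_p(Φg, Φh) ≤ ( Σ_{i=1}^N a_i ‖S_i‖_{L^∞(X_i)}^p ) · d_p(g,h) for all g,h ∈ L^p[0,1], where d_p(g,h) := ∫_0^1 |g − h|^p dx. In particular, if Σ_{i=1}^N a_i ‖S_i‖_{L^∞(X_i)}^p < 1, then Φ is a contraction with respect to the complete metric d_p and has a unique fixed point 𝔣 ∈ L^p[0,1]. -/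

import Mathlib

open MeasureTheory Set
open scoped ENNReal

lemma ofReal_abs_rpow_eq_enorm_rpow {p : ℝ} (hp : 0 ≤ p) (a : ℝ) :
    ENNReal.ofReal (|a| ^ p) = ‖a‖ₑ ^ p := by
  rw [Real.enorm_eq_ofReal_abs, ENNReal.ofReal_rpow_of_nonneg (abs_nonneg a) hp]

lemma enorm_add_rpow_le {p : ℝ} (hp0 : 0 ≤ p) (hp1 : p ≤ 1) (a b : ℝ) :
    ‖a + b‖ₑ ^ p ≤ ‖a‖ₑ ^ p + ‖b‖ₑ ^ p :=
  (ENNReal.rpow_le_rpow (enorm_add_le a b) hp0).trans (ENNReal.rpow_add_le_add_rpow _ _ hp0 hp1)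

lemma enorm_sub_rpow_le {p : ℝ} (hp0 : 0 ≤ p) (hp1 : p ≤ 1) (a b c : ℝ) :
    ‖a - c‖ₑ ^ p ≤ ‖a - b‖ₑ ^ p + ‖b - c‖ₑ ^ p := by
  simpa using enorm_add_rpow_le hp0 hp1 (a - b) (b - c)

lemma enorm_sum_rpow_le {ι : Type*} {p : ℝ} (hp0 : 0 < p) (hp1 : p ≤ 1) (s : Finset ι)
    (a : ι → ℝ) : ‖∑ i ∈ s, a i‖ₑ ^ p ≤ ∑ i ∈ s, ‖a i‖ₑ ^ p := by
  classical
  induction s using Finset.induction_on with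
  | empty => simp [hp0]
  | insert i s hi ih =>
    rw [Finset.sum_insert hi, Finset.sum_insert hi]
    exact (enorm_add_rpow_le hp0.le hp1 _ _).trans (by gcongr)

/-- The metric `d_p` between two functions, as an extended nonnegative real. -/
noncomputable def lpDist {α : Type*} [MeasurableSpace α] (μ : Measure α) (p : ℝ)
    (g h : α → ℝ) : ℝ≥0∞ :=
  ∫⁻ x, ‖g x - h x‖ₑ ^ p ∂μ

section lpDist

variable {α : Type*} [MeasurableSpace α] {μ : Measure α} {p : ℝ}

lemma lpDist_comm (g h : α → ℝ) : lpDist μ p g h = lpDist μ p h g := by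
  simp only [lpDist, enorm_sub_rev]

lemma aemeasurable_enorm_sub_rpow {g h : α → ℝ} (hg : AEStronglyMeasurable g μ)
    (hh : AEStronglyMeasurable h μ) : AEMeasurable (fun x => ‖g x - h x‖ₑ ^ p) μ :=
  (hg.sub hh).enorm.pow_const p

lemma lpDist_triangle (hp0 : 0 ≤ p) (hp1 : p ≤ 1) {f g : α → ℝ} (h : α → ℝ)
    (hf : AEStronglyMeasurable f μ) (hg : AEStronglyMeasurable g μ) :
    lpDist μ p f h ≤ lpDist μ p f g + lpDist μ p g h := by
  unfold lpDist
  rw [← lintegral_add_left' (aemeasurable_enorm_sub_rpow hf hg)]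
  exact lintegral_mono fun x => enorm_sub_rpow_le hp0 hp1 _ _ _

lemma ae_eq_of_lpDist_eq_zero (hp0 : 0 < p) {f g : α → ℝ}
    (hf : AEStronglyMeasurable f μ) (hg : AEStronglyMeasurable g μ)
    (h : lpDist μ p f g = 0) : f =ᵐ[μ] g := by
  unfold lpDist at h
  rw [lintegral_eq_zero_iff' (aemeasurable_enorm_sub_rpow hf hg)] at h
  filter_upwards [h] with x hx
  simpa [ENNReal.rpow_eq_zero_iff, hp0, hp0.not_gt, sub_eq_zero] using hx

lemma cauchySeq_of_tsum_enorm_sub_rpow_ne_top (hp0 : 0 < p) (hp1 : p ≤ 1) {a : ℕ → ℝ}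
    (h : ∑' n, ‖a n - a (n + 1)‖ₑ ^ p ≠ ⊤) : CauchySeq a := by
  apply cauchySeq_of_summable_dist
  have hs : Summable fun n => dist (a n) (a (n + 1)) ^ p := by
    refine (ENNReal.summable_toReal h).congr fun n => ?_
    rw [← ENNReal.toReal_rpow, toReal_enorm, Real.dist_eq, Real.norm_eq_abs]
  refine Summable.of_norm_bounded_eventually hs ?_
  rw [Nat.cofinite_eq_atTop]
  filter_upwards [hs.tendsto_atTop_zero.eventually_lt_const one_pos] with n hn
  rw [Real.norm_of_nonneg dist_nonneg]
  have h1 : dist (a n) (a (n + 1)) ≤ 1 := by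
    by_contra! hlt
    exact hn.not_ge (Real.one_le_rpow hlt.le hp0.le)
  exact Real.self_le_rpow_of_le_one dist_nonneg h1 hp1

lemma enorm_sub_rpow_le_tsum (hp0 : 0 < p) (hp1 : p ≤ 1) {a : ℕ → ℝ} {l : ℝ}
    (h : Filter.Tendsto a Filter.atTop (nhds l)) (n : ℕ) :
    ‖a n - l‖ₑ ^ p ≤ ∑' k, ‖a (k + n) - a (k + n + 1)‖ₑ ^ p := by
  have hpart : ∀ m, ‖a n - a (m + n)‖ₑ ^ p ≤
      ∑ k ∈ Finset.range m, ‖a (k + n) - a (k + n + 1)‖ₑ ^ p := by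
    intro m
    have := enorm_sum_rpow_le hp0 hp1 (Finset.range m) fun k => a (k + n) - a (k + n + 1)
    have htel := Finset.sum_range_sub' (fun k => a (k + n)) m
    simp only [Nat.add_right_comm _ 1 n, zero_add] at htel
    rwa [htel] at this
  have hlim : Filter.Tendsto (fun m => ‖a n - a (m + n)‖ₑ ^ p) Filter.atTop
      (nhds (‖a n - l‖ₑ ^ p)) :=
    ((ENNReal.continuous_rpow_const (y := p)).tendsto _).comp
      ((continuous_enorm.tendsto _).comp
        (((Filter.tendsto_add_atTop_iff_nat n).2 h).const_sub (a n)))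
  exact le_of_tendsto' hlim fun m => (hpart m).trans (ENNReal.sum_le_tsum _)

/-- Completeness of `L^p` for `0 < p ≤ 1`, for sequences with summable consecutive distances. -/
lemma exists_tendsto_lpDist_zero (hp0 : 0 < p) (hp1 : p ≤ 1) {F : ℕ → α → ℝ}
    (hF : ∀ n, AEStronglyMeasurable (F n) μ)
    (hsum : ∑' n, lpDist μ p (F n) (F (n + 1)) ≠ ⊤) :
    ∃ f, AEStronglyMeasurable f μ ∧
      Filter.Tendsto (fun n => lpDist μ p (F n) f) Filter.atTop (nhds 0) := by
  have hmeas : ∀ n, AEMeasurable (fun x => ‖F n x - F (n + 1) x‖ₑ ^ p) μ := fun n =>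
    aemeasurable_enorm_sub_rpow (hF n) (hF (n + 1))
  have hfin : ∀ᵐ x ∂μ, ∑' n, ‖F n x - F (n + 1) x‖ₑ ^ p < ⊤ := by
    refine ae_lt_top' (AEMeasurable.tsum hmeas) ?_
    rwa [lintegral_tsum hmeas]
  obtain ⟨f, hf, hlim⟩ := exists_stronglyMeasurable_limit_of_tendsto_ae hF
    (hfin.mono fun x hx => cauchySeq_tendsto_of_complete
      (cauchySeq_of_tsum_enorm_sub_rpow_ne_top (a := fun n => F n x) hp0 hp1 hx.ne))
  refine ⟨f, hf.aestronglyMeasurable, ?_⟩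
  refine tendsto_of_tendsto_of_tendsto_of_le_of_le tendsto_const_nhds
    (ENNReal.tendsto_sum_nat_add _ hsum) (fun _ => zero_le) fun n => ?_
  refine (lintegral_mono_ae (hlim.mono fun x hx => enorm_sub_rpow_le_tsum hp0 hp1 hx n)).trans ?_
  rw [lintegral_tsum fun k => hmeas (k + n)]
  rfl

/-- Banach's fixed point theorem in `L^p` for `0 < p ≤ 1`. -/
lemma exists_unique_fixedPoint_of_lpDist_le (hp0 : 0 < p) (hp1 : p ≤ 1)
    {T : (α → ℝ) → α → ℝ} {C : ℝ≥0∞} (hC : C < 1)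
    (hmaps : ∀ g, AEStronglyMeasurable g μ → lpDist μ p g 0 < ⊤ →
      AEStronglyMeasurable (T g) μ ∧ lpDist μ p (T g) 0 < ⊤)
    (hlip : ∀ g h, AEStronglyMeasurable g μ → lpDist μ p g 0 < ⊤ →
      AEStronglyMeasurable h μ → lpDist μ p h 0 < ⊤ →
      lpDist μ p (T g) (T h) ≤ C * lpDist μ p g h) :
    ∃ f, (AEStronglyMeasurable f μ ∧ lpDist μ p f 0 < ⊤) ∧ T f =ᵐ[μ] f ∧
      ∀ g, AEStronglyMeasurable g μ → lpDist μ p g 0 < ⊤ → T g =ᵐ[μ] g → g =ᵐ[μ] f := by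
  have hiter : ∀ n, AEStronglyMeasurable (T^[n] 0) μ ∧ lpDist μ p (T^[n] 0) 0 < ⊤ := by
    intro n
    induction n with
    | zero => exact ⟨aestronglyMeasurable_zero, by simp [lpDist, hp0]⟩
    | succ n ih =>
      rw [Function.iterate_succ_apply']
      exact hmaps _ ih.1 ih.2
  have hdist : ∀ n, lpDist μ p (T^[n] 0) (T^[n + 1] 0) ≤ C ^ n * lpDist μ p (T 0) 0 := by
    intro n
    induction n with
    | zero => simp [lpDist_comm]
    | succ n ih =>
      rw [Function.iterate_succ_apply' T n, Function.iterate_succ_apply' T (n + 1), pow_succ',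
        mul_assoc]
      refine (hlip _ _ (hiter n).1 (hiter n).2 (hiter (n + 1)).1 (hiter (n + 1)).2).trans ?_
      gcongr
  have hsum : ∑' n, lpDist μ p (T^[n] 0) (T^[n + 1] 0) ≠ ⊤ := by
    refine ne_top_of_le_ne_top ?_ (ENNReal.tsum_le_tsum hdist)
    rw [ENNReal.tsum_mul_right, ENNReal.tsum_geometric]
    exact ENNReal.mul_ne_top (ENNReal.inv_ne_top.2 (tsub_pos_of_lt hC).ne') (hiter 1).2.ne
  obtain ⟨f, hf, hlim⟩ := exists_tendsto_lpDist_zero hp0 hp1 (fun n => (hiter n).1) hsum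
  have hffin : lpDist μ p f 0 < ⊤ := by
    obtain ⟨n, hn⟩ := (hlim.eventually_lt_const one_pos).exists
    refine (lpDist_triangle hp0.le hp1 0 hf (hiter n).1).trans_lt ?_
    rw [lpDist_comm f]
    exact ENNReal.add_lt_top.2 ⟨hn.trans ENNReal.one_lt_top, (hiter n).2⟩
  obtain ⟨hTf, -⟩ := hmaps f hf hffin
  have hfix : T f =ᵐ[μ] f := by
    refine ae_eq_of_lpDist_eq_zero hp0 hTf hf (le_antisymm ?_ zero_le)
    have hbound : ∀ n, lpDist μ p (T f) f ≤
        lpDist μ p (T^[n] 0) f + lpDist μ p (T^[n + 1] 0) f := by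
      intro n
      refine (lpDist_triangle hp0.le hp1 f hTf (hiter (n + 1)).1).trans ?_
      gcongr
      rw [Function.iterate_succ_apply']
      refine (hlip _ _ hf hffin (hiter n).1 (hiter n).2).trans ?_
      rw [lpDist_comm f]
      exact mul_le_of_le_one_left' hC.le
    have hzero := hlim.add ((Filter.tendsto_add_atTop_iff_nat 1).2 hlim)
    rw [add_zero] at hzero
    exact ge_of_tendsto' hzero hbound
  refine ⟨f, ⟨hf, hffin⟩, hfix, fun g hg hgfin hgfix => ?_⟩
  have hle : lpDist μ p g f ≤ C * lpDist μ p g f := by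
    refine le_trans (le_of_eq ?_) (hlip g f hg hgfin hf hffin)
    refine lintegral_congr_ae ?_
    filter_upwards [hfix, hgfix] with x hx hy
    rw [hx, hy]
  have hlt : lpDist μ p g f < ⊤ := by
    refine (lpDist_triangle hp0.le hp1 f hg aestronglyMeasurable_zero).trans_lt ?_
    rw [lpDist_comm 0]
    exact ENNReal.add_lt_top.2 ⟨hgfin, hffin⟩
  refine ae_eq_of_lpDist_eq_zero hp0 hg hf ?_
  by_contra hne
  refine hle.not_gt ?_
  simpa using ENNReal.mul_lt_mul_left hne hlt.ne hC

end lpDist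

lemma lintegral_image_affine {c : ℝ} (hc : c ≠ 0) (d : ℝ) {X : Set ℝ} (hX : MeasurableSet X)
    (F : ℝ → ℝ≥0∞) :
    ∫⁻ z in (fun x => c * x + d) '' X, F ((z - d) / c) =
      ENNReal.ofReal |c| * ∫⁻ x in X, F x := by
  rw [lintegral_image_eq_lintegral_abs_deriv_mul hX (f' := fun _ => c)
    (fun x _ => by
      simpa using (((hasDerivAt_id x).const_mul c).add_const d).hasDerivWithinAt)
    (fun x _ y _ hxy => by simpa [hc] using hxy)]
  rw [lintegral_const_mul' _ _ ENNReal.ofReal_ne_top]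
  simp [hc]

lemma quasiMeasurePreserving_sub_div {c : ℝ} (hc : c ≠ 0) (d : ℝ) :
    Measure.QuasiMeasurePreserving (fun z : ℝ => (z - d) / c) := by
  have hmul : Measure.QuasiMeasurePreserving (fun z : ℝ => z * c⁻¹) :=
    ⟨by fun_prop, by
      rw [Real.map_volume_mul_right (inv_ne_zero hc)]
      exact Measure.smul_absolutelyContinuous⟩
  simpa [Function.comp_def, div_eq_mul_inv] using
    hmul.comp (measurePreserving_sub_right volume d).quasiMeasurePreserving

lemma aestronglyMeasurable_comp_sub_div {c : ℝ} (hc : c ≠ 0) (d : ℝ) {X : Set ℝ} {F : ℝ → ℝ}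
    (hF : AEStronglyMeasurable F (volume.restrict X)) :
    AEStronglyMeasurable (fun z => F ((z - d) / c))
      (volume.restrict ((fun x => c * x + d) '' X)) := by
  refine hF.comp_quasiMeasurePreserving
    ((quasiMeasurePreserving_sub_div hc d).restrict (t := X) ?_)
  rintro _ ⟨x, hx, rfl⟩
  simpa [hc] using hx

lemma lintegral_enorm_mul_rpow_le {α : Type*} [MeasurableSpace α] {μ : Measure α} {p : ℝ}
    (hp : 0 ≤ p) {S : α → ℝ} (hS : eLpNorm S ⊤ μ < ⊤) (g : α → ℝ) :
    ∫⁻ x, ‖S x * g x‖ₑ ^ p ∂μ ≤ eLpNorm S ⊤ μ ^ p * ∫⁻ x, ‖g x‖ₑ ^ p ∂μ := by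
  rw [← lintegral_const_mul' _ _ (ENNReal.rpow_ne_top_of_nonneg hp hS.ne)]
  refine lintegral_mono_ae ?_
  rw [eLpNorm_exponent_top]
  filter_upwards [enorm_ae_le_eLpNormEssSup S μ] with x hx
  rw [enorm_mul, ENNReal.mul_rpow_of_nonneg _ _ hp]
  gcongr

lemma aestronglyMeasurable_indicator_comp_sub_div {c d : ℝ} (hc : c ≠ 0) {X E : Set ℝ}
    (hE : MeasurableSet E) (hEX : E =ᵐ[volume] (fun x => c * x + d) '' X) {F : ℝ → ℝ}
    (hF : AEStronglyMeasurable F (volume.restrict X)) :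
    AEStronglyMeasurable (E.indicator fun z => F ((z - d) / c)) volume := by
  rw [aestronglyMeasurable_indicator_iff hE, Measure.restrict_congr_set hEX]
  exact aestronglyMeasurable_comp_sub_div hc d hF

lemma lintegral_enorm_sum_indicator_rpow_le {ι : Type*} [Fintype ι] {p : ℝ} (hp0 : 0 < p)
    (hp1 : p ≤ 1) {c d : ι → ℝ} (hc : ∀ i, c i ≠ 0) {X E : ι → Set ℝ}
    (hX : ∀ i, MeasurableSet (X i)) (hE : ∀ i, MeasurableSet (E i))
    (hEX : ∀ i, E i =ᵐ[volume] (fun x => c i * x + d i) '' X i) {F : ι → ℝ → ℝ}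
    (hF : ∀ i, AEStronglyMeasurable (F i) (volume.restrict (X i))) :
    ∫⁻ x, ‖∑ i, (E i).indicator (fun z => F i ((z - d i) / c i)) x‖ₑ ^ p ≤
      ∑ i, ENNReal.ofReal |c i| * ∫⁻ x in X i, ‖F i x‖ₑ ^ p := by
  refine (lintegral_mono fun x => enorm_sum_rpow_le hp0 hp1 _ _).trans_eq ?_
  rw [lintegral_finsetSum' _ fun i _ => (aestronglyMeasurable_indicator_comp_sub_div (hc i)
    (hE i) (hEX i) (hF i)).enorm.pow_const p]
  refine Finset.sum_congr rfl fun i _ => ?_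
  have hind : (fun x => ‖(E i).indicator (fun z => F i ((z - d i) / c i)) x‖ₑ ^ p) =
      (E i).indicator fun z => ‖F i ((z - d i) / c i)‖ₑ ^ p := by
    funext x
    by_cases hx : x ∈ E i <;> simp [hx, hp0]
  rw [hind, lintegral_indicator (hE i), Measure.restrict_congr_set (hEX i)]
  exact lintegral_image_affine (hc i) (d i) (hX i) fun x => ‖F i x‖ₑ ^ p

/-- The affine Read–Bajraktarević operator on `L^p[0,1]` for `0 < p < 1` (an F-space with
the metric `d_p(g,h) = ∫₀¹ |g-h|^p`), built from affine maps `uᵢ(x) = cᵢx + dᵢ` taking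
half-open intervals `Xᵢ = [pᵢ,qᵢ)` onto the pieces of a partition `0 = t₀ < ⋯ < t_N = 1`
(the last piece closed), with `∫_{Xᵢ} |λᵢ|^p < ∞` and `Sᵢ ∈ L^∞(Xᵢ)`, maps `L^p[0,1]`
into itself and satisfies `d_p(Φg, Φh) ≤ (∑ᵢ aᵢ ‖Sᵢ‖_∞^p) d_p(g,h)` where `aᵢ = |cᵢ|`;
if `∑ᵢ aᵢ ‖Sᵢ‖_∞^p < 1` it is a contraction with a unique fixed point in `L^p[0,1]`. -/
theorem stmt13 (N : ℕ) (hN : 0 < N) (p : ℝ) (hp0 : 0 < p) (hp1 : p < 1)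
    (t : Fin (N + 1) → ℝ) (ht0 : t 0 = 0) (htN : t (Fin.last N) = 1) (htm : StrictMono t)
    (pa qa : Fin N → ℝ) (hpq : ∀ i, pa i < qa i)
    (hsub : ∀ i, Ico (pa i) (qa i) ⊆ Icc (0 : ℝ) 1)
    (c d : Fin N → ℝ) (hc : ∀ i, c i ≠ 0)
    (him : ∀ i, (fun x => c i * x + d i) '' Ico (pa i) (qa i) =
      Ico (t i.castSucc) (t i.succ))
    (E : Fin N → Set ℝ)
    (hE : ∀ i, E i = if (i : ℕ) + 1 < N then Ico (t i.castSucc) (t i.succ)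
      else Icc (t i.castSucc) (t i.succ))
    (lam S : Fin N → ℝ → ℝ)
    (hlam : ∀ i, AEStronglyMeasurable (lam i) (volume.restrict (Ico (pa i) (qa i))) ∧
      ∫⁻ x in Ico (pa i) (qa i), ENNReal.ofReal (|lam i x| ^ p) < ⊤)
    (hS : ∀ i, MemLp (S i) ⊤ (volume.restrict (Ico (pa i) (qa i))))
    (Φ : (ℝ → ℝ) → (ℝ → ℝ))
    (hΦ : ∀ g x, Φ g x = ∑ i, Set.indicator (E i)
      (fun z => lam i ((z - d i) / c i) + S i ((z - d i) / c i) * g ((z - d i) / c i)) x)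
    (C : ℝ≥0∞)
    (hC : C = ∑ i, ENNReal.ofReal |c i| *
      (eLpNorm (S i) ⊤ (volume.restrict (Ico (pa i) (qa i)))) ^ p) :
    (∀ g, AEStronglyMeasurable g (volume.restrict (Icc (0 : ℝ) 1)) →
      (∫⁻ x in Icc (0 : ℝ) 1, ENNReal.ofReal (|g x| ^ p)) < ⊤ →
      AEStronglyMeasurable (Φ g) (volume.restrict (Icc (0 : ℝ) 1)) ∧
      (∫⁻ x in Icc (0 : ℝ) 1, ENNReal.ofReal (|Φ g x| ^ p)) < ⊤) ∧
    (∀ g h, AEStronglyMeasurable g (volume.restrict (Icc (0 : ℝ) 1)) →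
      (∫⁻ x in Icc (0 : ℝ) 1, ENNReal.ofReal (|g x| ^ p)) < ⊤ →
      AEStronglyMeasurable h (volume.restrict (Icc (0 : ℝ) 1)) →
      (∫⁻ x in Icc (0 : ℝ) 1, ENNReal.ofReal (|h x| ^ p)) < ⊤ →
      (∫⁻ x in Icc (0 : ℝ) 1, ENNReal.ofReal (|Φ g x - Φ h x| ^ p)) ≤
        C * ∫⁻ x in Icc (0 : ℝ) 1, ENNReal.ofReal (|g x - h x| ^ p)) ∧
    (C < 1 →
      ∃ f, (AEStronglyMeasurable f (volume.restrict (Icc (0 : ℝ) 1)) ∧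
          (∫⁻ x in Icc (0 : ℝ) 1, ENNReal.ofReal (|f x| ^ p)) < ⊤) ∧
        Φ f =ᵐ[volume.restrict (Icc (0 : ℝ) 1)] f ∧
        ∀ g, AEStronglyMeasurable g (volume.restrict (Icc (0 : ℝ) 1)) →
          (∫⁻ x in Icc (0 : ℝ) 1, ENNReal.ofReal (|g x| ^ p)) < ⊤ →
          Φ g =ᵐ[volume.restrict (Icc (0 : ℝ) 1)] g →
          g =ᵐ[volume.restrict (Icc (0 : ℝ) 1)] f) := by
  have hX : ∀ i, MeasurableSet (Ico (pa i) (qa i)) := fun i => measurableSet_Ico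
  have hEm : ∀ i, MeasurableSet (E i) := by
    intro i
    rw [hE i]
    split_ifs
    exacts [measurableSet_Ico, measurableSet_Icc]
  have hEX : ∀ i, E i =ᵐ[volume] (fun x => c i * x + d i) '' Ico (pa i) (qa i) := by
    intro i
    rw [him i, hE i]
    split_ifs
    exacts [Filter.EventuallyEq.rfl, Ico_ae_eq_Icc.symm]
  have hle : ∀ i, volume.restrict (Ico (pa i) (qa i)) ≤ volume.restrict (Icc (0 : ℝ) 1) :=
    fun i => Measure.restrict_mono_set volume (hsub i)
  have hCtop : C < ⊤ := by
    rw [hC]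
    exact ENNReal.sum_lt_top.2 fun i _ => ENNReal.mul_lt_top ENNReal.ofReal_lt_top
      (ENNReal.rpow_lt_top_of_nonneg hp0.le (hS i).2.ne)
  have hmeas : ∀ g, AEStronglyMeasurable g (volume.restrict (Icc (0 : ℝ) 1)) →
      AEStronglyMeasurable (Φ g) (volume.restrict (Icc (0 : ℝ) 1)) := by
    intro g hg
    rw [funext (hΦ g)]
    exact Finset.aestronglyMeasurable_fun_sum _ fun i _ =>
      (aestronglyMeasurable_indicator_comp_sub_div (F := fun x => lam i x + S i x * g x)
        (hc i) (hEm i) (hEX i)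
        ((hlam i).1.add ((hS i).1.mul (hg.mono_measure (hle i))))).restrict
  have hlip : ∀ g h, AEStronglyMeasurable g (volume.restrict (Icc (0 : ℝ) 1)) →
      AEStronglyMeasurable h (volume.restrict (Icc (0 : ℝ) 1)) →
      lpDist (volume.restrict (Icc (0 : ℝ) 1)) p (Φ g) (Φ h) ≤
        C * lpDist (volume.restrict (Icc (0 : ℝ) 1)) p g h := by
    intro g h hg hh
    have hdiff : ∀ x, Φ g x - Φ h x = ∑ i, (E i).indicator
        (fun z => S i ((z - d i) / c i) * (g ((z - d i) / c i) - h ((z - d i) / c i))) x := by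
      intro x
      rw [hΦ, hΦ, ← Finset.sum_sub_distrib]
      refine Finset.sum_congr rfl fun i _ => ?_
      by_cases hx : x ∈ E i
      · simp only [indicator_of_mem hx]
        ring
      · simp [hx]
    simp only [lpDist, hdiff]
    refine (setLIntegral_le_lintegral _ _).trans ?_
    refine (lintegral_enorm_sum_indicator_rpow_le (F := fun i x => S i x * (g x - h x))
      hp0 hp1.le hc hX hEm hEX fun i =>
        (hS i).1.mul ((hg.sub hh).mono_measure (hle i))).trans ?_
    rw [hC, Finset.sum_mul]
    refine Finset.sum_le_sum fun i _ => ?_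
    rw [mul_assoc]
    gcongr
    refine (lintegral_enorm_mul_rpow_le hp0.le (hS i).2 fun x => g x - h x).trans ?_
    gcongr
    exact hsub i
  have hzero : lpDist (volume.restrict (Icc (0 : ℝ) 1)) p (Φ 0) 0 < ⊤ := by
    simp only [lpDist, hΦ, Pi.zero_apply, mul_zero, add_zero, sub_zero]
    refine (setLIntegral_le_lintegral _ _).trans_lt ?_
    refine (lintegral_enorm_sum_indicator_rpow_le hp0 hp1.le hc hX hEm hEX
      fun i => (hlam i).1).trans_lt ?_
    refine ENNReal.sum_lt_top.2 fun i _ => ENNReal.mul_lt_top ENNReal.ofReal_lt_top ?_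
    simpa only [ofReal_abs_rpow_eq_enorm_rpow hp0.le] using (hlam i).2
  have hmaps : ∀ g, AEStronglyMeasurable g (volume.restrict (Icc (0 : ℝ) 1)) →
      lpDist (volume.restrict (Icc (0 : ℝ) 1)) p g 0 < ⊤ →
      AEStronglyMeasurable (Φ g) (volume.restrict (Icc (0 : ℝ) 1)) ∧
        lpDist (volume.restrict (Icc (0 : ℝ) 1)) p (Φ g) 0 < ⊤ := by
    intro g hg hgfin
    refine ⟨hmeas g hg, ?_⟩
    refine (lpDist_triangle hp0.le hp1.le 0 (hmeas g hg)
      (hmeas 0 aestronglyMeasurable_zero)).trans_lt (ENNReal.add_lt_top.2 ⟨?_, hzero⟩)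
    exact (hlip g 0 hg aestronglyMeasurable_zero).trans_lt (ENNReal.mul_lt_top hCtop hgfin)
  have hnorm : ∀ g : ℝ → ℝ, ∫⁻ x in Icc (0 : ℝ) 1, ENNReal.ofReal (|g x| ^ p) =
      lpDist (volume.restrict (Icc (0 : ℝ) 1)) p g 0 := fun g => by
    simp [lpDist, ofReal_abs_rpow_eq_enorm_rpow hp0.le]
  have hdist : ∀ g h : ℝ → ℝ, ∫⁻ x in Icc (0 : ℝ) 1, ENNReal.ofReal (|g x - h x| ^ p) =
      lpDist (volume.restrict (Icc (0 : ℝ) 1)) p g h := fun g h => by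
    simp [lpDist, ofReal_abs_rpow_eq_enorm_rpow hp0.le]
  simp only [hdist]
  simp only [hnorm]
  exact ⟨hmaps, fun g h hg _ hh _ => hlip g h hg hh, fun hC1 =>
    exists_unique_fixedPoint_of_lpDist_le hp0 hp1.le hC1 hmaps
      fun g h hg _ hh _ => hlip g h hg hh⟩
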